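/- arXiv:1611.08892 — 2 statements merged into one kernel-verified Lean document; each statement's English description precedes it below -/
import Mathlib

section
/- Let A be an input for the team power game with n teams and m time slots and let a_max := max_{i,j} A i j be the maximum true availability. If there exists a time slot j* whose column sum satisfies ∑_i A i j* ≥ 2 · a_max, then A admits a 1-strong Nash equilibrium. -/
open Finset

section TPG

variable {T C : Type*} [Fintype T] [Fintype C] [DecidableEq T] [DecidableEq C]

/-- Sum of declared availabilities at a time slot. -/
def colSum (B : T → C → ℕ) (j : C) : ℕ := ∑ i, B i j

/-- Winning time slots: those maximizing the column sum. -/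
def winners (B : T → C → ℕ) : Finset C :=
  Finset.univ.filter fun j => ∀ j', colSum B j' ≤ colSum B j

/-- Relative power of team `i` at slot `j` (0 when the denominator is 0). -/
def power (B : T → C → ℕ) (i : T) (j : C) : ℚ :=
  (B i j : ℚ) / (colSum B j : ℚ)

/-- Pay-off of team `i`: minimum relative power over all winning slots. -/
def payoff (B : T → C → ℕ) (i : T) : ℚ :=
  if h : (winners B).Nonempty then (winners B).inf' h (power B i) else 0

/-- `B` is a strategy profile for input `A`. -/
def IsProfile (A B : T → C → ℕ) : Prop := ∀ i j, B i j ≤ A i j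

/-- `D` is an improvement step for coalition `S` with respect to `B` (for input `A`). -/
def IsImprovement (A B : T → C → ℕ) (S : Finset T) (D : T → C → ℕ) : Prop :=
  IsProfile A D ∧ (∀ i ∉ S, ∀ j, D i j = B i j) ∧ ∀ i ∈ S, payoff B i < payoff D i

/-- `B` is a `t`-strong Nash equilibrium for `A`. -/
def IsStrongNash (t : ℕ) (A B : T → C → ℕ) : Prop :=
  IsProfile A B ∧
    ∀ S : Finset T, S.Nonempty → S.card ≤ t → ∀ D, ¬ IsImprovement A B S D

end TPG

section Concentrated

variable {T C : Type*} [Fintype T]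

/-- The profile declaring the availabilities `A` at slot `j₀` and nothing elsewhere. -/
def concentrated [DecidableEq C] (A : T → C → ℕ) (j₀ : C) : T → C → ℕ := fun i j =>
  if j = j₀ then A i j else 0

theorem payoff_le_power [Fintype C] {B : T → C → ℕ} {j : C} (hj : j ∈ winners B) (i : T) :
    payoff B i ≤ power B i j := by
  rw [payoff, dif_pos ⟨j, hj⟩]
  exact Finset.inf'_le _ hj

theorem le_payoff [Fintype C] {B : T → C → ℕ} {i : T} {q : ℚ} (hne : (winners B).Nonempty)
    (hq : ∀ j ∈ winners B, q ≤ power B i j) : q ≤ payoff B i := by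
  rw [payoff, dif_pos hne]
  exact Finset.le_inf' _ _ hq

theorem colSum_eq_add_sum_erase [DecidableEq T] (B : T → C → ℕ) (i : T) (j : C) :
    colSum B j = B i j + ∑ i' ∈ Finset.univ.erase i, B i' j :=
  (Finset.add_sum_erase _ _ (Finset.mem_univ i)).symm

theorem div_add_le_div_add {d a : ℕ} (r : ℕ) (h : d ≤ a) :
    (d : ℚ) / ((d + r : ℕ) : ℚ) ≤ (a : ℚ) / ((a + r : ℕ) : ℚ) := by
  rcases Nat.eq_zero_or_pos d with rfl | hd
  · simp only [Nat.cast_zero, zero_div]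
    positivity
  · have hd' : (0 : ℚ) < d := by exact_mod_cast hd
    have ha' : (0 : ℚ) < a := by exact_mod_cast hd.trans_le h
    have h' : (d : ℚ) ≤ a := by exact_mod_cast h
    push_cast
    rw [div_le_div_iff₀ (by positivity) (by positivity)]
    nlinarith [mul_le_mul_of_nonneg_right h' (Nat.cast_nonneg (α := ℚ) r)]

theorem colSum_concentrated_self [DecidableEq C] (A : T → C → ℕ) (j₀ : C) :
    colSum (concentrated A j₀) j₀ = colSum A j₀ := by
  simp [colSum, concentrated]

theorem colSum_concentrated_of_ne [DecidableEq C] (A : T → C → ℕ) {j₀ j : C} (hj : j ≠ j₀) :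
    colSum (concentrated A j₀) j = 0 := by
  simp [colSum, concentrated, hj]

theorem mem_winners_concentrated [Fintype C] [DecidableEq C] (A : T → C → ℕ) (j₀ : C) :
    j₀ ∈ winners (concentrated A j₀) := by
  simp only [winners, Finset.mem_filter, Finset.mem_univ, true_and]
  intro j
  by_cases hj : j = j₀
  · rw [hj]
  · simp [colSum_concentrated_of_ne A hj]

theorem power_le_payoff_concentrated [Fintype C] [DecidableEq C] (A : T → C → ℕ) (j₀ : C) (i : T) :
    power A i j₀ ≤ payoff (concentrated A j₀) i := by
  refine le_payoff ⟨j₀, mem_winners_concentrated A j₀⟩ fun j hj => ?_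
  by_cases hjj : j = j₀
  · subst hjj
    simp [power, colSum_concentrated_self, concentrated]
  · simp only [winners, Finset.mem_filter, Finset.mem_univ, true_and] at hj
    have hs := hj j₀
    rw [colSum_concentrated_self, colSum_concentrated_of_ne A hjj] at hs
    simp [power, Nat.le_zero.mp hs, colSum_concentrated_of_ne A hjj]

/-- If the column sum at `j₀` is at least twice every availability, then no single team can gain
by deviating from the profile concentrated at `j₀`. -/
theorem isStrongNash_one_concentrated [Fintype C] [DecidableEq T] [DecidableEq C]
    {A : T → C → ℕ} {j₀ : C} {M : ℕ} (hA : ∀ i j, A i j ≤ M) (hM : 2 * M ≤ colSum A j₀) :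
    IsStrongNash 1 A (concentrated A j₀) := by
  refine ⟨fun i j => by unfold concentrated; split_ifs <;> simp, ?_⟩
  rintro S hS hcard D ⟨hD, hfix, himp⟩
  obtain ⟨i, rfl⟩ := Finset.card_eq_one.mp (le_antisymm hcard hS.card_pos)
  have hrest (j : C) : ∑ i' ∈ Finset.univ.erase i, D i' j =
      ∑ i' ∈ Finset.univ.erase i, concentrated A j₀ i' j :=
    Finset.sum_congr rfl fun i' hi' => hfix i' (by simpa using Finset.ne_of_mem_erase hi') j
  have hDj₀ : colSum D j₀ = D i j₀ + ∑ i' ∈ Finset.univ.erase i, A i' j₀ := by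
    rw [colSum_eq_add_sum_erase D i, hrest]
    simp [concentrated]
  have hwin : j₀ ∈ winners D := by
    simp only [winners, Finset.mem_filter, Finset.mem_univ, true_and]
    intro j
    by_cases hj : j = j₀
    · rw [hj]
    · have hDj : colSum D j = D i j := by
        rw [colSum_eq_add_sum_erase D i, hrest]
        simp [concentrated, hj]
      have := colSum_eq_add_sum_erase A i j₀
      have := hA i j₀
      have := hA i j
      have := hD i j
      omega
  refine (himp i (Finset.mem_singleton_self i)).not_ge ?_
  calc payoff D i ≤ power D i j₀ := payoff_le_power hwin i
    _ ≤ power A i j₀ := by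
      rw [power, power, hDj₀, colSum_eq_add_sum_erase A i]
      exact div_add_le_div_add _ (hD i j₀)
    _ ≤ payoff (concentrated A j₀) i := power_le_payoff_concentrated A j₀ i

end Concentrated

/-- If some time slot has column sum at least twice the maximum true availability,
then a 1-strong Nash equilibrium exists. -/
theorem one_strong_nash_of_large_column_sum {n m : ℕ} (A : Fin n → Fin m → ℕ)
    (jstar : Fin m)
    (h : 2 * (Finset.univ.sup fun i : Fin n => Finset.univ.sup fun j : Fin m => A i j)
          ≤ ∑ i, A i jstar) :
    ∃ B : Fin n → Fin m → ℕ, IsStrongNash 1 A B := by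
  refine ⟨concentrated A jstar, isStrongNash_one_concentrated (fun i j => ?_) h⟩
  exact (Finset.le_sup (f := fun j => A i j) (Finset.mem_univ j)).trans
    (Finset.le_sup (f := fun i => Finset.univ.sup fun j => A i j) (Finset.mem_univ i))
end

section
/- Let A be an input for the team power game with n teams and m time slots such that every entry of A is at most 1 (i.e., the maximum true availability a_max satisfies a_max ≤ 1). Then A admits a 2-strong Nash equilibrium, i.e., there exists a strategy profile B for A such that no nonempty coalition of at most two teams has an improvement step with respect to B. -/
open Finset

section TPG

variable {T C : Type*} {A B D : T → C → ℕ} {S : Finset T} {i : T} {j w : C}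

lemma isProfile_self (A : T → C → ℕ) : IsProfile A A := fun _ _ => le_rfl

lemma sum_le_card (h : IsProfile A B) (hmax : ∀ i j, A i j ≤ 1) (S : Finset T) (j : C) :
    ∑ i ∈ S, B i j ≤ S.card := by
  simpa using Finset.sum_le_card_nsmul S (fun i => B i j) 1
    fun i _ => (h i j).trans (hmax i j)

variable [Fintype T]

lemma colSum_mono (h : IsProfile A B) (j : C) : colSum B j ≤ colSum A j :=
  Finset.sum_le_sum fun i _ => h i j

lemma single_le_colSum (B : T → C → ℕ) (i : T) (j : C) : B i j ≤ colSum B j :=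
  Finset.single_le_sum (f := fun i => B i j) (fun _ _ => Nat.zero_le _) (Finset.mem_univ i)

lemma sum_le_colSum (B : T → C → ℕ) (S : Finset T) (j : C) : ∑ i ∈ S, B i j ≤ colSum B j :=
  Finset.sum_le_sum_of_subset (Finset.subset_univ S)

/-- A slot available to exactly three teams is determined by those teams. -/
lemma column_eq_of_colSum_eq_three {A : T → C → ℕ} {S : Finset T} {r : T} {j k : C}
    (hS : S.card = 2) (hr : r ∉ S)
    (hj : colSum A j = 3) (hk : colSum A k = 3) (hSj : ∀ i ∈ S, A i j = 1)
    (hSk : ∀ i ∈ S, A i k = 1) (hrj : A r j = 1) (hrk : A r k = 1) (i : T) :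
    A i j = A i k := by
  classical
  have key : ∀ l, colSum A l = 3 → (∀ i ∈ S, A i l = 1) → A r l = 1 →
      ∀ i, i ∉ insert r S → A i l = 0 := by
    intro l hl hSl hrl i hi
    have := sum_le_colSum A (insert i (insert r S)) l
    rw [Finset.sum_insert hi, Finset.sum_insert hr, Finset.sum_congr rfl hSl, hrl, hl] at this
    simp only [Finset.sum_const, hS, smul_eq_mul] at this
    omega
  by_cases hi : i ∈ insert r S
  · rcases Finset.mem_insert.1 hi with rfl | hi
    · rw [hrj, hrk]
    · rw [hSj i hi, hSk i hi]
  · rw [key j hj hSj hrj i hi, key k hk hSk hrk i hi]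

variable [Fintype C]

lemma mem_winners : j ∈ winners B ↔ ∀ j', colSum B j' ≤ colSum B j := by
  simp [winners]

lemma payoff_le_power_s8 (hw : w ∈ winners B) : payoff B i ≤ power B i w := by
  rw [payoff, dif_pos ⟨w, hw⟩]
  exact Finset.inf'_le _ hw

lemma payoff_nonneg (B : T → C → ℕ) (i : T) : 0 ≤ payoff B i := by
  unfold payoff
  split_ifs with h
  · exact Finset.le_inf' _ _ fun j _ => div_nonneg (Nat.cast_nonneg _) (Nat.cast_nonneg _)
  · exact le_rfl

namespace IsImprovement

lemma exists_winner (h : IsImprovement A B S D) (hS : S.Nonempty) : ∃ w, w ∈ winners D := by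
  obtain ⟨i, hi⟩ := hS
  by_contra hne
  have hlt := h.2.2 i hi
  have hD : payoff D i = 0 := dif_neg hne
  linarith [payoff_nonneg B i]

lemma apply_winner (h : IsImprovement A B S D) (hmax : ∀ i j, A i j ≤ 1) (hi : i ∈ S)
    (hw : w ∈ winners D) : D i w = 1 := by
  have hlt := (payoff_nonneg B i).trans_lt ((h.2.2 i hi).trans_le (payoff_le_power_s8 hw))
  have hne : D i w ≠ 0 := fun h0 => by simp [power, h0] at hlt
  have := (h.1 i w).trans (hmax i w)
  omega

/-- A team present in all winning slots can only improve if the maximum column sum drops. -/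
lemma colSum_lt (h : IsImprovement A B S D) (hmax : ∀ i j, A i j ≤ 1) (hi : i ∈ S)
    (hw : w ∈ winners D) (hj : j ∈ winners B) (hB : ∀ j ∈ winners B, B i j = 1) :
    colSum D w < colSum B j := by
  have hDi := h.apply_winner hmax hi hw
  have hlt := (h.2.2 i hi).trans_le (payoff_le_power_s8 hw)
  obtain ⟨k, hk, hpk⟩ := Finset.exists_mem_eq_inf' ⟨j, hj⟩ (power B i)
  rw [payoff, dif_pos ⟨j, hj⟩, hpk, power, power, hB k hk, hDi] at hlt
  have hkj : colSum B k ≤ colSum B j := mem_winners.1 hj k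
  have hDpos : 0 < colSum D w := by have := single_le_colSum D i w; omega
  have hBpos : 0 < colSum B k := by have := single_le_colSum B i k; rw [hB k hk] at this; omega
  rw [Nat.cast_one, one_div_lt_one_div (by exact_mod_cast hBpos) (by exact_mod_cast hDpos)] at hlt
  have : colSum D w < colSum B k := by exact_mod_cast hlt
  omega

lemma colSum_add (h : IsImprovement A B S D) (j : C) :
    colSum D j + ∑ i ∈ S, B i j = colSum B j + ∑ i ∈ S, D i j := by
  classical
  have hc : ∑ i ∈ Sᶜ, D i j = ∑ i ∈ Sᶜ, B i j :=
    Finset.sum_congr rfl fun i hi => h.2.1 i (Finset.mem_compl.1 hi) j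
  have hD := Finset.sum_add_sum_compl S fun i => D i j
  have hB := Finset.sum_add_sum_compl S fun i => B i j
  simp only [colSum]
  omega

lemma colSum_eq (h : IsImprovement A B S D) (hj : ∀ i ∈ S, D i j = B i j) :
    colSum D j = colSum B j := by
  have := h.colSum_add j
  rw [Finset.sum_congr rfl hj] at this
  omega

lemma sum_winner (h : IsImprovement A B S D) (hmax : ∀ i j, A i j ≤ 1)
    (hw : w ∈ winners D) : ∑ i ∈ S, D i w = S.card := by
  rw [Finset.sum_congr rfl fun i hi => h.apply_winner hmax hi hw]
  simp

end IsImprovement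

/-- If some slot is available to exactly two or to at least four teams, it is an equilibrium
that everybody declares that slot only. -/
lemma isStrongNash_single_slot [DecidableEq C] (hmax : ∀ i j, A i j ≤ 1) {j : C}
    (hj : colSum A j = 2 ∨ 4 ≤ colSum A j) :
    IsStrongNash 2 A fun i j' => if j' = j then A i j' else 0 := by
  set B : T → C → ℕ := fun i j' => if j' = j then A i j' else 0 with hB
  have hprof : IsProfile A B := fun i j' => by simp only [hB]; split_ifs <;> simp
  have hBj : ∀ i, B i j = A i j := by simp [hB]
  have hsum : colSum B j = colSum A j := by simp [colSum, hBj]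
  have hB0 : ∀ j', j' ≠ j → ∀ i, B i j' = 0 := fun j' h i => by simp [hB, h]
  have hsum0 : ∀ j', j' ≠ j → colSum B j' = 0 := fun j' h => by simp [colSum, hB0 j' h]
  have hwin : ∀ j', j' ∈ winners B ↔ j' = j := by
    intro j'
    rw [mem_winners]
    constructor
    · intro h
      by_contra hne
      have := h j
      rw [hsum0 j' hne] at this
      omega
    · rintro rfl k
      by_cases hk : k = j'
      · rw [hk]
      · rw [hsum0 k hk]; exact Nat.zero_le _
  refine ⟨hprof, fun S hS hcard D h => ?_⟩
  obtain ⟨w, hw⟩ := h.exists_winner hS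
  have happy : ∀ i ∈ S, A i j = 1 → colSum D w < colSum A j := by
    intro i hi hA
    rw [← hsum]
    exact h.colSum_lt hmax hi hw ((hwin j).2 rfl) fun k hk => by
      rw [(hwin k).1 hk, hBj, hA]
  have hDj := h.colSum_add j
  have hDw := h.colSum_add w
  have hSw := h.sum_winner hmax hw
  have hSj := sum_le_card hprof hmax S j
  have hjw := mem_winners.1 hw j
  have hpos := hS.card_pos
  by_cases hwj : w = j
  · subst hwj
    obtain ⟨i, hi⟩ := hS
    have hone : ∀ i ∈ S, A i w = 1 := fun i hi => by
      have h1 := h.apply_winner hmax hi hw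
      have h2 := h.1 i w
      have h3 := hmax i w
      omega
    have := happy i hi (hone i hi)
    have := h.colSum_eq (j := w) fun i hi => by
      rw [h.apply_winner hmax hi hw, hBj, hone i hi]
    omega
  · have hz : ∑ i ∈ S, B i w = 0 := Finset.sum_eq_zero fun i _ => hB0 w hwj i
    rw [hsum0 w hwj] at hDw
    by_cases hex : ∃ i ∈ S, A i j = 1
    · obtain ⟨i, hi, hA⟩ := hex
      have := happy i hi hA
      by_cases hjwin : j ∈ winners D
      · have := h.sum_winner hmax hjwin
        have := mem_winners.1 hjwin w
        omega
      · have : colSum D j ≠ colSum D w := fun heq =>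
          hjwin (mem_winners.2 fun k => heq ▸ mem_winners.1 hw k)
        omega
    · have : ∑ i ∈ S, B i j = 0 := Finset.sum_eq_zero fun i hi => by
        rw [hBj]
        have := hmax i j
        by_contra hne
        exact hex ⟨i, hi, by omega⟩
      have hjwin : j ∈ winners D := mem_winners.2 fun k => by
        have := mem_winners.1 hw k
        omega
      obtain ⟨i, hi⟩ := hS
      have h1 := h.apply_winner hmax hi hjwin
      have h2 := h.1 i j
      have h3 := hmax i j
      exact hex ⟨i, hi, by omega⟩

/-- If no slot is available to more than one team, truth-telling is an equilibrium. -/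
lemma isStrongNash_self_of_colSum_le_one (hmax : ∀ i j, A i j ≤ 1)
    (hA : ∀ j, colSum A j ≤ 1) : IsStrongNash 2 A A := by
  refine ⟨isProfile_self A, fun S hS _ D h => ?_⟩
  obtain ⟨w, hw⟩ := h.exists_winner hS
  have hSw := h.sum_winner hmax hw
  have hle := sum_le_colSum D S w
  have hDw := colSum_mono h.1 w
  have hAw := hA w
  have hpos := hS.card_pos
  obtain ⟨i, rfl⟩ := Finset.card_eq_one.1 (show S.card = 1 by omega)
  have hi := Finset.mem_singleton_self i
  have hAwin : w ∈ winners A := mem_winners.2 fun k => by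
    have := hA k
    omega
  by_cases hall : ∀ j ∈ winners A, A i j = 1
  · have := h.colSum_lt hmax hi hw hAwin hall
    omega
  · push Not at hall
    obtain ⟨j, hj, hij⟩ := hall
    have hij0 : A i j = 0 := by have := hmax i j; omega
    have hD0 : D i j = 0 := by have := h.1 i j; omega
    have heq : colSum D j = colSum A j := h.colSum_eq fun k hk => by
      rw [Finset.mem_singleton.1 hk, hij0, hD0]
    have hjw := mem_winners.1 hj w
    have hjD : j ∈ winners D := mem_winners.2 fun k => by
      have := mem_winners.1 hw k
      omega
    have := h.apply_winner hmax hi hjD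
    omega

/-- If all slots are available to zero, one or three teams and every slot available to three teams
is disjoint from another such slot, truth-telling is an equilibrium. -/
lemma isStrongNash_self_of_disjoint (hmax : ∀ i j, A i j ≤ 1)
    (hA : ∀ j, colSum A j ≤ 1 ∨ colSum A j = 3) (hex : ∃ j, colSum A j = 3)
    (hdisj : ∀ j, colSum A j = 3 → ∃ h, colSum A h = 3 ∧ ∀ p, A p j = 1 → A p h = 0) :
    IsStrongNash 2 A A := by
  refine ⟨isProfile_self A, fun S hS hcard D h => ?_⟩
  obtain ⟨w, hw⟩ := h.exists_winner hS
  have hSw := h.sum_winner hmax hw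
  have hle := sum_le_colSum D S w
  have hDw := colSum_mono h.1 w
  rcases hA w with hw1 | hw3
  · obtain ⟨j, hj⟩ := hex
    have := h.colSum_add j
    have := sum_le_card (isProfile_self A) hmax S j
    have := mem_winners.1 hw j
    omega
  · obtain ⟨k, hk, hwk⟩ := hdisj w hw3
    have hk0 : ∀ i ∈ S, A i k = 0 := fun i hi => hwk i <| by
      have h1 := h.apply_winner hmax hi hw
      have h2 := h.1 i w
      have h3 := hmax i w
      omega
    have hD0 : ∀ i ∈ S, D i k = 0 := fun i hi => by
      have := h.1 i k
      have := hk0 i hi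
      omega
    have heq : colSum D k = colSum A k := h.colSum_eq fun i hi => by rw [hk0 i hi, hD0 i hi]
    have hkD : k ∈ winners D := mem_winners.2 fun l => by
      have := mem_winners.1 hw l
      omega
    obtain ⟨i, hi⟩ := hS
    have := h.apply_winner hmax hi hkD
    have := hD0 i hi
    omega

/-- If all slots are available to zero, one or three teams and the slot `j` available to three teams
meets all other such slots, then there is an equilibrium in which `j` wins: from every slot
available to three teams but different from `j`, one team of `j` withdraws. -/
lemma exists_isStrongNash_of_meets (hmax : ∀ i j, A i j ≤ 1)
    (hA : ∀ j, colSum A j ≤ 1 ∨ colSum A j = 3) {j : C} (hj : colSum A j = 3)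
    (hmeet : ∀ k, colSum A k = 3 → ∃ p, A p j = 1 ∧ A p k = 1) :
    ∃ B : T → C → ℕ, IsStrongNash 2 A B := by
  classical
  have : Nonempty T := ⟨(hmeet j hj).choose⟩
  have hmeet' : ∀ k, ∃ p, colSum A k = 3 → A p j = 1 ∧ A p k = 1 := fun k => by
    by_cases hk : colSum A k = 3
    · obtain ⟨p, hp⟩ := hmeet k hk
      exact ⟨p, fun _ => hp⟩
    · exact ⟨Classical.arbitrary T, fun h => absurd h hk⟩
  choose p hp using hmeet'
  set B : T → C → ℕ := fun i k =>
    if colSum A k = 3 ∧ (∃ r, A r k ≠ A r j) ∧ i = p k then 0 else A i k with hB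
  have hprof : IsProfile A B := fun i k => by simp only [hB]; split_ifs <;> simp
  have hcopy : ∀ k, (∀ r, A r k = A r j) → ∀ i, B i k = A i k := fun k hk i => by
    simp only [hB]
    rw [if_neg]
    rintro ⟨-, ⟨r, hr⟩, -⟩
    exact hr (hk r)
  have hout : ∀ i, A i j = 0 → ∀ k, B i k = A i k := fun i hi k => by
    simp only [hB]
    rw [if_neg]
    rintro ⟨hk, -, rfl⟩
    have := (hp k hk).1
    omega
  have hBj : ∀ i, B i j = A i j := hcopy j fun _ => rfl
  have hsum : colSum B j = 3 := by rw [← hj]; simp [colSum, hBj]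
  have hA3 : ∀ k, colSum A k ≤ 3 := fun k => by have := hA k; omega
  have hjwin : j ∈ winners B := mem_winners.2 fun k => by
    rw [hsum]
    exact (colSum_mono hprof k).trans (hA3 k)
  have hwin : ∀ k ∈ winners B, ∀ r, A r k = A r j := by
    intro k hk
    by_contra! hne
    have h3 : colSum B j ≤ colSum B k := mem_winners.1 hk j
    have hAk : colSum A k = 3 := le_antisymm (hA3 k) (by
      have := colSum_mono hprof k
      omega)
    have hlt : colSum B k < colSum A k :=
      Finset.sum_lt_sum (fun i _ => hprof i k) ⟨p k, Finset.mem_univ _, by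
        have : B (p k) k = 0 := if_pos ⟨hAk, hne, rfl⟩
        rw [this, (hp k hAk).2]
        exact Nat.one_pos⟩
    omega
  refine ⟨B, hprof, fun S hS hcard D h => ?_⟩
  obtain ⟨w, hw⟩ := h.exists_winner hS
  have happy : ∀ i ∈ S, A i j = 1 → colSum D w < 3 := fun i hi hij => by
    rw [← hsum]
    exact h.colSum_lt hmax hi hw hjwin fun k hk => by
      rw [hcopy k (hwin k hk), hwin k hk, hij]
  have hDj := h.colSum_add j
  have hSw := h.sum_winner hmax hw
  have hwS := sum_le_colSum D S w
  have hDw3 := (colSum_mono h.1 w).trans (hA3 w)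
  have hjw := mem_winners.1 hw j
  have hjD : colSum D j = colSum D w → ∀ i ∈ S, D i j = 1 := fun heq i hi =>
    h.apply_winner hmax hi (mem_winners.2 fun k => heq ▸ mem_winners.1 hw k)
  have hSBj := sum_le_card hprof hmax S j
  by_cases hall : ∀ i ∈ S, A i j = 1
  · obtain ⟨i, hi⟩ := hS
    have hlt := happy i hi (hall i hi)
    have hne : colSum D j ≠ colSum D w := fun heq => by
      have := h.colSum_eq (j := j) fun i hi => by rw [hjD heq i hi, hBj, hall i hi]
      omega
    have hS2 : S.card = 2 := by omega
    have hSwA : ∀ i ∈ S, A i w = 1 := fun i hi => by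
      have h1 := h.apply_winner hmax hi hw
      have h2 := h.1 i w
      have h3 := hmax i w
      omega
    have hAw : colSum A w = 3 := by
      have := hA w
      have := colSum_mono h.1 w
      omega
    obtain ⟨r, hr, hrw⟩ : ∃ r ∉ S, A r w = 1 := by
      by_contra! hno
      have hz : ∑ i ∈ Sᶜ, A i w = 0 := Finset.sum_eq_zero fun i hi => by
        have := hno i (Finset.mem_compl.1 hi)
        have := hmax i w
        omega
      have hs := Finset.sum_add_sum_compl S fun i => A i w
      have := sum_le_card (isProfile_self A) hmax S w
      simp only [colSum] at hAw
      omega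
    have hDr : D r w = 0 := by
      have := sum_le_colSum D (insert r S) w
      rw [Finset.sum_insert hr] at this
      omega
    have hBr : B r w = 0 := by rw [← h.2.1 r hr w, hDr]
    have hcond : colSum A w = 3 ∧ (∃ r, A r w ≠ A r j) ∧ r = p w := by
      by_contra hcon
      simp only [hB, if_neg hcon] at hBr
      omega
    obtain ⟨-, ⟨t, ht⟩, hrp⟩ := hcond
    have hrj : A r j = 1 := hrp ▸ (hp w hAw).1
    exact ht (column_eq_of_colSum_eq_three hS2 hr hAw hj hSwA hall hrw hrj t)
  · push Not at hall
    obtain ⟨i, hi, hij⟩ := hall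
    have hij0 : A i j = 0 := by have := hmax i j; omega
    have hne : colSum D j ≠ colSum D w := fun heq => by
      have := hjD heq i hi
      have := h.1 i j
      omega
    have herase := Finset.sum_erase_add S (fun i => B i j) hi
    have hle := sum_le_card hprof hmax (S.erase i) j
    rw [Finset.card_erase_of_mem hi] at hle
    have hBi : B i j = 0 := by rw [hBj, hij0]
    by_cases hk : ∃ k ∈ S, A k j = 1
    · obtain ⟨k, hk, hkj⟩ := hk
      have := happy k hk hkj
      omega
    · have : ∑ i ∈ S, B i j = 0 := Finset.sum_eq_zero fun k hkS => by
        rw [hBj]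
        have := hmax k j
        by_contra hne
        exact hk ⟨k, hkS, by omega⟩
      omega

end TPG

/-- If the maximum true availability is at most one, then the team power game
always admits a 2-strong Nash equilibrium. -/
theorem two_strong_nash_exists_of_amax_le_one {n m : ℕ} (A : Fin n → Fin m → ℕ)
    (hmax : ∀ i j, A i j ≤ 1) :
    ∃ B : Fin n → Fin m → ℕ, IsStrongNash 2 A B := by
  by_cases h24 : ∃ j, colSum A j = 2 ∨ 4 ≤ colSum A j
  · obtain ⟨j, hj⟩ := h24
    exact ⟨_, isStrongNash_single_slot hmax hj⟩
  have hA : ∀ j, colSum A j ≤ 1 ∨ colSum A j = 3 := fun j => by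
    have : ¬(colSum A j = 2 ∨ 4 ≤ colSum A j) := fun h => h24 ⟨j, h⟩
    omega
  by_cases h3 : ∃ j, colSum A j = 3
  · by_cases hmeet : ∃ j, colSum A j = 3 ∧ ∀ k, colSum A k = 3 → ∃ p, A p j = 1 ∧ A p k = 1
    · obtain ⟨j, hj, hjk⟩ := hmeet
      exact exists_isStrongNash_of_meets hmax hA hj hjk
    · push Not at hmeet
      refine ⟨A, isStrongNash_self_of_disjoint hmax hA h3 fun j hj => ?_⟩
      obtain ⟨k, hk, hjk⟩ := hmeet j hj
      refine ⟨k, hk, fun p hpj => ?_⟩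
      have := hjk p hpj
      have := hmax p k
      omega
  · refine ⟨A, isStrongNash_self_of_colSum_le_one hmax fun j => ?_⟩
    have : colSum A j ≠ 3 := fun h => h3 ⟨j, h⟩
    have := hA j
    omega
end
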